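/- Central limit theorem for the bifurcation ratio of general order: for every fixed order r ≥ 1, the random variables √n·(S_{r+1,n}/S_{r,n} − 1/4) converge in distribution, as n → ∞, to the normal distribution N(0, 4^{r−3}). -/

import Mathlib

open MeasureTheory ProbabilityTheory Filter
open scoped NNReal Topology

/-- Binary trees: every internal node has exactly two children. -/
inductive BinTree : Type
  | leaf : BinTree
  | node : BinTree → BinTree → BinTree
  deriving DecidableEq

namespace BinTree

/-- The magnitude of a binary tree is its number of leaves. -/
def magnitude : BinTree → ℕ
  | leaf => 1
  | node l r => magnitude l + magnitude r

/-- The Horton–Strahler order of (the root of) a binary tree: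
leaves have order 1; a node whose two children have distinct orders has the max of the two;
a node whose two children have equal order `r` has order `r + 1`. -/
def ord : BinTree → ℕ
  | leaf => 1
  | node l r => if ord l = ord r then ord l + 1 else max (ord l) (ord r)

/-- `branches k τ` is `S_{k,n}(τ)`, the number of Horton–Strahler branches of order `k`
in `τ`, i.e. the number of maximal connected paths of nodes of order `k`.  It counts the
nodes of order `k` that head a branch: a new branch head of order `ord l + 1` is created
exactly at a node whose two children have equal order `ord l`, and every leaf heads an
order-1 branch. -/
def branches (k : ℕ) : BinTree → ℕ
  | leaf => if k = 1 then 1 else 0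
  | node l r => branches k l + branches k r +
      (if ord l = ord r ∧ ord l + 1 = k then 1 else 0)

end BinTree

/-- `treesOf n` is the finite set `Ω_n` of binary trees of magnitude `n`. -/
def treesOf : ℕ → Finset BinTree
  | 0 => ∅
  | 1 => {BinTree.leaf}
  | (n+2) => (Finset.range (n+1)).attach.biUnion fun k =>
      ((treesOf (k.1+1)) ×ˢ (treesOf (n+1-k.1))).image fun p => BinTree.node p.1 p.2
  decreasing_by
  · have := Finset.mem_range.mp k.2; omega
  · omega

/-- Expectation `⟨f⟩` under the uniform probability measure `P_n` on `Ω_n` (the random model). -/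
noncomputable def expect (n : ℕ) (f : BinTree → ℝ) : ℝ :=
  (∑ τ ∈ treesOf n, f τ) / (treesOf n).card

lemma magnitude_of_mem_treesOf {n : ℕ} {τ : BinTree} (h : τ ∈ treesOf n) : τ.magnitude = n := by
  induction τ generalizing n with
  | leaf =>
    match n with
    | 0 => simp [treesOf] at h
    | 1 => rfl
    | n + 2 => simp [treesOf] at h
  | node l r ihl ihr =>
    match n with
    | 0 => simp [treesOf] at h
    | 1 => simp [treesOf] at h
    | n + 2 =>
      simp only [treesOf, Finset.mem_biUnion, Finset.mem_attach, true_and, Finset.mem_image,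
        Finset.mem_product, Subtype.exists, Finset.mem_range, Prod.exists] at h
      obtain ⟨k, hk, a, b, ⟨ha, hb⟩, hab⟩ := h
      simp only [BinTree.node.injEq] at hab
      obtain ⟨rfl, rfl⟩ := hab
      simp only [BinTree.magnitude, ihl ha, ihr hb]
      omega

lemma sum_treesOf_add_two {M : Type*} [AddCommMonoid M] (n : ℕ) (F : BinTree → M) :
    ∑ τ ∈ treesOf (n + 2), F τ =
      ∑ p ∈ Finset.HasAntidiagonal.antidiagonal (n + 2), ∑ a ∈ treesOf p.1, ∑ b ∈ treesOf p.2, F (.node a b) := by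
  rw [Finset.Nat.antidiagonal_succ, Finset.sum_cons, Finset.sum_map,
    Finset.Nat.sum_antidiagonal_eq_sum_range_succ_mk, Finset.sum_range_succ]
  simp only [treesOf, Finset.sum_empty, zero_add, Function.Embedding.prodMap,
    Function.Embedding.coeFn_mk, Prod.map, Nat.succ_eq_add_one, tsub_self,
    Function.Embedding.refl_apply, Finset.sum_const_zero, add_zero]
  rw [Finset.sum_biUnion, Finset.sum_attach (Finset.range (n + 1)) (fun k =>
    ∑ τ ∈ (treesOf (k + 1) ×ˢ treesOf (n + 1 - k)).image fun p => BinTree.node p.1 p.2, F τ)]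
  · refine Finset.sum_congr rfl fun k _ => ?_
    rw [Finset.sum_image, Finset.sum_product]
    rintro ⟨a, b⟩ _ ⟨c, d⟩ _ h
    simpa using h
  · rintro ⟨i, hi⟩ _ ⟨j, hj⟩ _ hij
    rw [Function.onFun, Finset.disjoint_left]
    simp only [Finset.mem_image, Finset.mem_product, Prod.exists]
    rintro τ ⟨a, b, ⟨ha, _⟩, rfl⟩ ⟨c, d, ⟨hc, _⟩, h⟩
    simp only [BinTree.node.injEq] at h
    obtain ⟨rfl, rfl⟩ := h
    exact hij (Subtype.ext (Nat.succ_injective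
      ((magnitude_of_mem_treesOf ha).symm.trans (magnitude_of_mem_treesOf hc))))

/-- The generating series of a weight on binary trees, graded by magnitude. -/
noncomputable def treeSeries (F : BinTree → ℤ) : PowerSeries ℤ :=
  PowerSeries.mk fun n => ∑ τ ∈ treesOf n, F τ

lemma treeSeries_eq (F G₁ H₁ G₂ H₂ G₃ H₃ : BinTree → ℤ)
    (h : ∀ a b, F (.node a b) = G₁ a * H₁ b + G₂ a * H₂ b + G₃ a * H₃ b) :
    treeSeries F = PowerSeries.C (F .leaf) * PowerSeries.X +
      (treeSeries G₁ * treeSeries H₁ + treeSeries G₂ * treeSeries H₂ +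
        treeSeries G₃ * treeSeries H₃) := by
  ext n
  rw [map_add, PowerSeries.coeff_C_mul, PowerSeries.coeff_X]
  simp only [treeSeries, PowerSeries.coeff_mk, map_add, PowerSeries.coeff_mul]
  match n with
  | 0 => simp [treesOf]
  | 1 => simp [treesOf, Finset.Nat.antidiagonal_succ]
  | n + 2 =>
    rw [sum_treesOf_add_two]
    simp [h, Finset.sum_mul_sum, Finset.sum_add_distrib]

lemma card_treesOf_succ (n : ℕ) : (treesOf (n + 1)).card = catalan n := by
  induction n using Nat.strong_induction_on with
  | _ n ih =>
    match n with
    | 0 => simp [treesOf]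
    | n + 1 =>
      rw [catalan_succ', Finset.card_eq_sum_ones, sum_treesOf_add_two,
        Finset.Nat.antidiagonal_succ, Finset.sum_cons, Finset.sum_map,
        Finset.Nat.antidiagonal_succ', Finset.sum_cons, Finset.sum_map]
      simp only [treesOf, Finset.card_empty, zero_mul, mul_zero, zero_add,
        Function.Embedding.prodMap, Function.Embedding.coeFn_mk, Prod.map,
        Function.Embedding.refl_apply, Nat.succ_eq_add_one, Finset.sum_const, smul_eq_mul, mul_one]
      refine Finset.sum_congr rfl fun p hp => ?_
      have := Finset.HasAntidiagonal.mem_antidiagonal.1 hp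
      rw [ih p.1 (by omega), ih p.2 (by omega)]

lemma card_treesOf_recurrence (m : ℕ) :
    (m + 2) * (treesOf (m + 2)).card = 2 * (2 * m + 1) * (treesOf (m + 1)).card := by
  rw [card_treesOf_succ, card_treesOf_succ]
  have h1 := succ_mul_catalan_eq_centralBinom m
  have h2 := succ_mul_catalan_eq_centralBinom (m + 1)
  have h3 := Nat.succ_mul_centralBinom_succ m
  rw [← h1, ← h2] at h3
  refine Nat.eq_of_mul_eq_mul_left (Nat.succ_pos m) ?_
  rw [Nat.succ_eq_add_one]
  linarith

lemma card_treesOf_pos {n : ℕ} (hn : 1 ≤ n) : 0 < (treesOf n).card := by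
  obtain ⟨k, rfl⟩ : ∃ k, n = k + 1 := ⟨n - 1, by omega⟩
  rw [card_treesOf_succ]
  have := succ_mul_catalan_eq_centralBinom k
  have := Nat.centralBinom_pos k
  by_contra! h
  simp_all

namespace BinTree

/-- Horton pruning: delete the leaves and contract the resulting unary chains. -/
def prune : BinTree → Option BinTree
  | leaf => none
  | node l r =>
    match prune l, prune r with
    | none, none => some leaf
    | none, some b => some b
    | some a, none => some a
    | some a, some b => some (node a b)

lemma prune_eq_none {τ : BinTree} : τ.prune = none ↔ τ = leaf := by
  cases τ with
  | leaf => simp [prune]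
  | node l r => simp only [prune]; split <;> simp

lemma one_le_ord (τ : BinTree) : 1 ≤ τ.ord := by
  induction τ with
  | leaf => simp [ord]
  | node l r ihl ihr => simp only [ord]; split_ifs <;> omega

lemma one_le_magnitude (τ : BinTree) : 1 ≤ τ.magnitude := by
  induction τ with
  | leaf => simp [magnitude]
  | node l r ihl ihr => simp only [magnitude]; omega

lemma branches_one (τ : BinTree) : τ.branches 1 = τ.magnitude := by
  induction τ with
  | leaf => simp [branches, magnitude]
  | node l r ihl ihr =>
    have := one_le_ord l
    simp only [branches, magnitude, ihl, ihr]
    rw [if_neg (by omega), add_zero]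

lemma ord_prune (τ : BinTree) : τ.ord = τ.prune.elim 0 ord + 1 := by
  induction τ with
  | leaf => simp [ord, prune]
  | node l r ihl ihr =>
    simp only [ord, prune, ihl, ihr]
    cases hl : prune l <;> cases hr : prune r <;> simp [ord]
    · rename_i a
      have := one_le_ord a
      omega
    · rename_i a
      have := one_le_ord a
      omega
    · split_ifs <;> omega

lemma branches_prune {k : ℕ} (hk : 1 ≤ k) (τ : BinTree) :
    τ.branches (k + 1) = τ.prune.elim 0 (branches k) := by
  induction τ with
  | leaf => simp [branches, prune]; omega
  | node l r ihl ihr =>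
    have hl := ord_prune l
    have hr := ord_prune r
    simp only [branches, ihl, ihr]
    cases hpl : prune l <;> cases hpr : prune r <;>
      simp only [prune, hl, hr, hpl, hpr, Option.elim, branches]
    · grind
    · rename_i a
      have := one_le_ord a
      rw [if_neg (by omega)]; simp
    · rename_i a
      have := one_le_ord a
      rw [if_neg (by omega)]; simp
    · grind

lemma magnitude_prune_le (τ : BinTree) : τ.prune.elim 0 magnitude ≤ τ.magnitude := by
  induction τ with
  | leaf => simp [prune]
  | node l r ihl ihr =>
    have := one_le_magnitude l
    simp only [prune, magnitude]
    cases hl : prune l <;> cases hr : prune r <;> simp_all [magnitude] <;> omega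

lemma branches_le_magnitude {k : ℕ} (hk : 1 ≤ k) (τ : BinTree) : τ.branches k ≤ τ.magnitude := by
  induction k, hk using Nat.le_induction generalizing τ with
  | base => rw [branches_one]
  | succ k hk ih =>
    rw [branches_prune hk]
    refine le_trans ?_ (magnitude_prune_le τ)
    cases prune τ with
    | none => simp
    | some σ => exact ih σ

end BinTree

open BinTree

lemma treeSeries_leaf : treeSeries (fun τ => if τ = leaf then 1 else 0) = PowerSeries.X := by
  rw [treeSeries_eq _ 0 0 0 0 0 0 (by simp)]
  have : treeSeries 0 = 0 := by ext; simp [treeSeries]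
  simp [this]

lemma one_sub_two_X_mul_treeSeries (F G H : BinTree → ℤ) (h0 : F leaf = 0)
    (h : ∀ a b, F (.node a b) = F a * (if b = leaf then 1 else 0) +
      (if a = leaf then 1 else 0) * F b + G a * H b) :
    (1 - 2 * PowerSeries.X) * treeSeries F = treeSeries G * treeSeries H := by
  have key := treeSeries_eq F F (fun τ => if τ = leaf then 1 else 0)
    (fun τ => if τ = leaf then 1 else 0) F G H h
  rw [h0, treeSeries_leaf, map_zero] at key
  linear_combination key

lemma one_sub_pow_mul_treeSeries_prune (σ : BinTree) :
    (1 - 2 * PowerSeries.X) ^ (2 * σ.magnitude - 1) *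
      treeSeries (fun τ => if τ.prune = some σ then 1 else 0) =
      PowerSeries.X ^ (2 * σ.magnitude) := by
  have h0 (τ : BinTree) : (if τ = leaf then (1 : ℤ) else 0) = if τ.prune = none then 1 else 0 := by
    simp [prune_eq_none]
  induction σ with
  | leaf =>
    have key := one_sub_two_X_mul_treeSeries
      (fun τ => if τ.prune = some leaf then 1 else 0) (fun τ => if τ = leaf then 1 else 0)
      (fun τ => if τ = leaf then 1 else 0) (by simp [prune])
      (by
        intro a b
        simp only [h0]
        cases ha : prune a <;> cases hb : prune b <;> simp [prune, ha, hb])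
    rw [treeSeries_leaf] at key
    simp only [magnitude]
    linear_combination key
  | node s t ihs iht =>
    have key := one_sub_two_X_mul_treeSeries
      (fun τ => if τ.prune = some (node s t) then 1 else 0)
      (fun τ => if τ.prune = some s then 1 else 0)
      (fun τ => if τ.prune = some t then 1 else 0) (by simp [prune])
      (by
        intro a b
        simp only [h0]
        cases ha : prune a <;> cases hb : prune b <;> (simp [prune, ha, hb, ite_and]; try grind))
    have hs := one_le_magnitude s
    have ht := one_le_magnitude t
    simp only [magnitude]
    have e : 2 * (s.magnitude + t.magnitude) - 1 =
      (2 * s.magnitude - 1) + (2 * t.magnitude - 1) + 1 := by omega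
    rw [e, mul_add, pow_add PowerSeries.X, ← ihs, ← iht, pow_succ, pow_add]
    linear_combination (1 - 2 * PowerSeries.X) ^ (2 * s.magnitude - 1) *
      (1 - 2 * PowerSeries.X) ^ (2 * t.magnitude - 1) * key

/-- The number of trees of magnitude `n` that prune to a given tree of magnitude `m`. -/
def fiberCount (n m : ℕ) : ℕ :=
  if 2 * m ≤ n then (n - 2).choose (2 * m - 2) * 2 ^ (n - 2 * m) else 0

lemma one_sub_two_X_pow_mul (d : ℕ) :
    (1 - 2 * PowerSeries.X : PowerSeries ℤ) ^ (d + 1) *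
      PowerSeries.mk (fun n => ((d + n).choose d * 2 ^ n : ℤ)) = 1 := by
  have h := congrArg (PowerSeries.rescale (2 : ℤ))
    (PowerSeries.mk_add_choose_mul_one_sub_pow_eq_one ℤ d)
  rw [map_mul, map_pow, map_sub, map_one, PowerSeries.rescale_X, PowerSeries.rescale_mk] at h
  rw [show PowerSeries.C (2 : ℤ) = 2 from rfl] at h
  rw [mul_comm]
  refine Eq.trans ?_ h
  congr 1
  ext n
  simp [mul_comm]

lemma card_filter_prune (n : ℕ) (σ : BinTree) :
    ((treesOf n).filter (fun τ => τ.prune = some σ)).card = fiberCount n σ.magnitude := by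
  have hm := one_le_magnitude σ
  have h := one_sub_pow_mul_treeSeries_prune σ
  have e : 2 * σ.magnitude - 1 = (2 * σ.magnitude - 2) + 1 := by omega
  have h2 := one_sub_two_X_pow_mul (2 * σ.magnitude - 2)
  rw [← e] at h2
  have h3 : treeSeries (fun τ => if τ.prune = some σ then 1 else 0) =
      PowerSeries.X ^ (2 * σ.magnitude) * PowerSeries.mk (fun n =>
        ((2 * σ.magnitude - 2 + n).choose (2 * σ.magnitude - 2) * 2 ^ n : ℤ)) := by
    rw [← h]
    linear_combination (-treeSeries (fun τ => if τ.prune = some σ then 1 else 0)) * h2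
  have h4 := congrArg (PowerSeries.coeff n) h3
  rw [PowerSeries.coeff_X_pow_mul', treeSeries, PowerSeries.coeff_mk] at h4
  rw [Finset.sum_boole] at h4
  rw [fiberCount]
  split_ifs at h4 ⊢ with hle
  · rw [PowerSeries.coeff_mk] at h4
    rw [show n - 2 = 2 * σ.magnitude - 2 + (n - 2 * σ.magnitude) by omega]
    exact_mod_cast h4
  · exact_mod_cast h4

lemma mem_treesOf_magnitude (τ : BinTree) : τ ∈ treesOf τ.magnitude := by
  induction τ with
  | leaf => simp [magnitude, treesOf]
  | node l r ihl ihr =>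
    obtain ⟨a, ha⟩ : ∃ a, l.magnitude = a + 1 := ⟨_, (Nat.sub_add_cancel (one_le_magnitude l)).symm⟩
    obtain ⟨b, hb⟩ : ∃ b, r.magnitude = b + 1 := ⟨_, (Nat.sub_add_cancel (one_le_magnitude r)).symm⟩
    rw [ha] at ihl
    rw [hb] at ihr
    rw [magnitude, ha, hb, show a + 1 + (b + 1) = (a + b) + 2 by ring]
    simp only [treesOf, Finset.mem_biUnion, Finset.mem_attach, true_and, Finset.mem_image,
        Finset.mem_product, Subtype.exists, Finset.mem_range, Prod.exists]
    refine ⟨a, by omega, l, r, ⟨ihl, ?_⟩, rfl⟩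
    rwa [show a + b + 1 - a = b + 1 by omega]

lemma sum_prune {M : Type*} [AddCommMonoid M] (n : ℕ) (H : Option BinTree → M) :
    ∑ τ ∈ treesOf n, H τ.prune = (if n = 1 then H none else 0) +
      ∑ m ∈ Finset.range (n + 1), fiberCount n m • ∑ σ ∈ treesOf m, H (some σ) := by
  have h1 : ∀ τ ∈ treesOf n, H τ.prune = (if τ = leaf then H none else 0) +
      ∑ m ∈ Finset.range (n + 1), ∑ σ ∈ treesOf m,
        if τ.prune = some σ then H (some σ) else 0 := by
    intro τ hτ
    have hmag := magnitude_prune_le τ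
    rw [magnitude_of_mem_treesOf hτ] at hmag
    cases hp : τ.prune with
    | none => simp [prune_eq_none.1 hp]
    | some σ =>
      rw [if_neg (fun h => by simp [h, prune] at hp), zero_add]
      simp only [hp, Option.elim] at hmag
      rw [Finset.sum_eq_single_of_mem σ.magnitude (Finset.mem_range.2 (by omega)),
        Finset.sum_eq_single_of_mem σ (mem_treesOf_magnitude σ)]
      · simp
      · intro b _ hb
        rw [if_neg (by simpa using hb.symm)]
      · intro m _ hm
        refine Finset.sum_eq_zero fun b hb => if_neg ?_
        rintro h
        simp only [Option.some.injEq] at h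
        subst h
        exact hm (magnitude_of_mem_treesOf hb).symm
  rw [Finset.sum_congr rfl h1, Finset.sum_add_distrib]
  congr 1
  · rw [Finset.sum_ite_eq']
    congr 1
    refine propext ⟨fun h => (magnitude_of_mem_treesOf h).symm, ?_⟩
    rintro rfl
    simp [treesOf]
  · rw [Finset.sum_comm]
    refine Finset.sum_congr rfl fun m _ => ?_
    rw [Finset.sum_comm, Finset.smul_sum]
    refine Finset.sum_congr rfl fun σ hσ => ?_
    rw [← Finset.sum_filter, Finset.sum_const, card_filter_prune, magnitude_of_mem_treesOf hσ]

lemma fiberCount_mul_card_recurrence {n : ℕ} (hn : 2 ≤ n) (m : ℕ) :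
    ((n : ℤ) - 2 * m) * (n - 2 * m - 1) * (fiberCount n m * (treesOf m).card) =
      4 * (m + 1) * m * (fiberCount n (m + 1) * (treesOf (m + 1)).card) := by
  rcases m with _ | m
  · simp [treesOf]
  have hc : ((m : ℤ) + 2) * (treesOf (m + 2)).card = 2 * (2 * m + 1) * (treesOf (m + 1)).card := by
    exact_mod_cast card_treesOf_recurrence m
  unfold fiberCount
  by_cases h1 : 2 * (m + 1 + 1) ≤ n
  · obtain ⟨j, rfl⟩ := Nat.exists_eq_add_of_le h1
    rw [if_pos h1, if_pos (by omega)]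
    rw [show 2 * (m + 1 + 1) + j - 2 = 2 * m + 2 + j by omega,
      show 2 * (m + 1) - 2 = 2 * m by omega, show 2 * (m + 1 + 1) - 2 = 2 * m + 2 by omega,
      show 2 * (m + 1 + 1) + j - 2 * (m + 1) = j + 2 by omega,
      show 2 * (m + 1 + 1) + j - 2 * (m + 1 + 1) = j by omega]
    have e1 := Nat.choose_succ_right_eq (2 * m + 2 + j) (2 * m)
    have e2 := Nat.choose_succ_right_eq (2 * m + 2 + j) (2 * m + 1)
    rw [show 2 * m + 2 + j - 2 * m = j + 2 by omega] at e1
    rw [show 2 * m + 2 + j - (2 * m + 1) = j + 1 by omega] at e2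
    have e1' : ((2 * m + 2 + j).choose (2 * m + 1) : ℤ) * (2 * m + 1) =
      (2 * m + 2 + j).choose (2 * m) * (j + 2) := by exact_mod_cast e1
    have e2' : ((2 * m + 2 + j).choose (2 * m + 2) : ℤ) * (2 * m + 2) =
      (2 * m + 2 + j).choose (2 * m + 1) * (j + 1) := by exact_mod_cast e2
    push_cast
    generalize ((2 * m + 2 + j).choose (2 * m) : ℤ) = A at *
    generalize ((2 * m + 2 + j).choose (2 * m + 1) : ℤ) = B at *
    generalize ((2 * m + 2 + j).choose (2 * m + 2) : ℤ) = C at *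
    generalize ((treesOf (m + 1)).card : ℤ) = c at *
    generalize ((treesOf (m + 2)).card : ℤ) = d at *
    linear_combination (-4 * 2 ^ j * c * (j + 1)) * e1' - 4 * 2 ^ j * c * (2 * m + 1) * e2' -
      4 * (m + 1) * C * 2 ^ j * hc
  · rw [if_neg h1]
    split_ifs with h2
    · have : (n : ℤ) - 2 * (m + 1) = 0 ∨ (n : ℤ) - 2 * (m + 1) - 1 = 0 := by omega
      push_cast
      rcases this with h | h <;> simp [h]
    · simp

/-- A Stein-type identity characterising the law of the number of branches of order two. -/
lemma sum_branches_two_identity {R : Type*} [CommRing R] (n : ℕ) (g : ℤ → R) :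
    ∑ τ ∈ treesOf n, (((n : R) - 2 * τ.branches 2) * (n - 2 * τ.branches 2 - 1) * g (τ.branches 2) -
      4 * τ.branches 2 * (τ.branches 2 - 1) * g (τ.branches 2 - 1)) = 0 := by
  match n with
  | 0 => simp [treesOf]
  | 1 => simp [treesOf, branches]
  | n + 2 =>
    set N := n + 2 with hN
    set T : ℕ → R := fun m => ((4 * m * (m - 1) * (fiberCount N m * (treesOf m).card) : ℤ) : R) *
      g (m - 1) with hT
    have hT' (m : ℕ) : T (m + 1) = ((((N : ℤ) - 2 * m) * (N - 2 * m - 1) *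
        (fiberCount N m * (treesOf m).card) : ℤ) : R) * g m := by
      rw [fiberCount_mul_card_recurrence (by omega) m]
      simp only [hT]
      push_cast
      ring_nf
    simp only [branches_prune le_rfl]
    rw [sum_prune N (fun o => ((N : R) - 2 * (o.elim 0 (branches 1) : ℕ)) *
      (N - 2 * (o.elim 0 (branches 1) : ℕ) - 1) * g (o.elim 0 (branches 1) : ℕ) -
      4 * (o.elim 0 (branches 1) : ℕ) * ((o.elim 0 (branches 1) : ℕ) - 1) *
        g ((o.elim 0 (branches 1) : ℕ) - 1)), if_neg (by omega), zero_add]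
    have : ∀ m ∈ Finset.range (N + 1), fiberCount N m • ∑ σ ∈ treesOf m,
        (((N : R) - 2 * (branches 1 σ : ℕ)) *
      (N - 2 * (branches 1 σ : ℕ) - 1) * g (branches 1 σ : ℕ) -
      4 * (branches 1 σ : ℕ) * ((branches 1 σ : ℕ) - 1) *
        g ((branches 1 σ : ℕ) - 1)) = T (m + 1) - T m := by
      intro m _
      rw [Finset.sum_congr rfl (fun σ hσ => by
        rw [branches_one, magnitude_of_mem_treesOf hσ]), Finset.sum_const, hT', nsmul_eq_mul,
        nsmul_eq_mul]
      simp only [hT]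
      push_cast
      ring
    simp only [Option.elim]
    rw [Finset.sum_congr rfl this, Finset.sum_range_sub, hT']
    have h0 : fiberCount N N = 0 := if_neg (by omega)
    simp [hT, h0]

/-- The mean of a vector-valued function under the uniform measure on trees of magnitude `n`. -/
noncomputable def treeAvg {E : Type*} [AddCommGroup E] [Module ℝ E] (n : ℕ) (f : BinTree → E) : E :=
  ((treesOf n).card : ℝ)⁻¹ • ∑ τ ∈ treesOf n, f τ

lemma expect_eq_treeAvg (n : ℕ) (f : BinTree → ℝ) : expect n f = treeAvg n f := by
  rw [expect, treeAvg, smul_eq_mul, div_eq_inv_mul]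

section treeAvg

variable {E : Type*} [AddCommGroup E] [Module ℝ E]

lemma treeAvg_congr {n : ℕ} {f g : BinTree → E} (h : ∀ τ ∈ treesOf n, f τ = g τ) :
    treeAvg n f = treeAvg n g := by
  rw [treeAvg, treeAvg, Finset.sum_congr rfl h]

lemma treeAvg_add (n : ℕ) (f g : BinTree → E) :
    treeAvg n (fun τ => f τ + g τ) = treeAvg n f + treeAvg n g := by
  simp [treeAvg, Finset.sum_add_distrib]

lemma treeAvg_sub (n : ℕ) (f g : BinTree → E) :
    treeAvg n (fun τ => f τ - g τ) = treeAvg n f - treeAvg n g := by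
  simp [treeAvg, smul_sub]

lemma treeAvg_const_mul {A : Type*} [Ring A] [Algebra ℝ A] (n : ℕ) (c : A) (f : BinTree → A) :
    treeAvg n (fun τ => c * f τ) = c * treeAvg n f := by
  simp [treeAvg, Finset.mul_sum]

lemma treeAvg_const {n : ℕ} (hn : 1 ≤ n) (c : E) : treeAvg n (fun _ => c) = c := by
  have := card_treesOf_pos hn
  rw [treeAvg, Finset.sum_const, ← Nat.cast_smul_eq_nsmul ℝ, inv_smul_smul₀ (by positivity)]

lemma treeAvg_mono {n : ℕ} {f g : BinTree → ℝ} (h : ∀ τ ∈ treesOf n, f τ ≤ g τ) :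
    treeAvg n f ≤ treeAvg n g :=
  smul_le_smul_of_nonneg_left (Finset.sum_le_sum h) (by positivity)

lemma norm_treeAvg_le {E : Type*} [NormedAddCommGroup E] [NormedSpace ℝ E] (n : ℕ)
    (f : BinTree → E) : ‖treeAvg n f‖ ≤ treeAvg n (fun τ => ‖f τ‖) := by
  rw [treeAvg, treeAvg, norm_smul, Real.norm_of_nonneg (by positivity), smul_eq_mul]
  gcongr
  exact norm_sum_le _ _

/-- Given the number of branches of order `k`, the number of branches of order `k + 1` is
distributed as the number of branches of order two in a uniform tree. -/
lemma treeAvg_branches_eq {k : ℕ} (hk : 1 ≤ k) (n : ℕ) (G : ℕ → ℕ → E) :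
    treeAvg n (fun τ => G (τ.branches k) (τ.branches (k + 1))) =
      treeAvg n (fun τ => if τ.branches k = 0 then G 0 0 else
        treeAvg (τ.branches k) (fun σ => G (τ.branches k) (σ.branches 2))) := by
  suffices h : ∑ τ ∈ treesOf n, G (τ.branches k) (τ.branches (k + 1)) =
      ∑ τ ∈ treesOf n, (if τ.branches k = 0 then G 0 0 else
        treeAvg (τ.branches k) (fun σ => G (τ.branches k) (σ.branches 2))) by
    rw [treeAvg, h, treeAvg]
  induction k, hk using Nat.le_induction generalizing n with
  | base =>
    rcases Nat.eq_zero_or_pos n with rfl | hn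
    · simp [treesOf]
    have hc := card_treesOf_pos hn
    have hL : ∀ τ ∈ treesOf n, G (τ.branches 1) (τ.branches (1 + 1)) = G n (τ.branches 2) := by
      intro τ hτ
      rw [branches_one, magnitude_of_mem_treesOf hτ]
    have hR : ∀ τ ∈ treesOf n, (if τ.branches 1 = 0 then G 0 0 else
        treeAvg (τ.branches 1) (fun σ => G (τ.branches 1) (σ.branches 2))) =
        treeAvg n (fun σ => G n (σ.branches 2)) := by
      intro τ hτ
      rw [branches_one, magnitude_of_mem_treesOf hτ, if_neg (by omega)]
    rw [Finset.sum_congr rfl hL, Finset.sum_congr rfl hR,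
      Finset.sum_const, treeAvg, ← Nat.cast_smul_eq_nsmul ℝ, smul_inv_smul₀ (by positivity)]
  | succ k hk ih =>
    simp only [branches_prune hk, branches_prune (show 1 ≤ k + 1 by omega)]
    rw [sum_prune n (fun o => G (o.elim 0 (branches k)) (o.elim 0 (branches (k + 1)))),
      sum_prune n (fun o => if o.elim 0 (branches k) = 0 then G 0 0 else
        treeAvg (o.elim 0 (branches k)) (fun σ => G (o.elim 0 (branches k)) (σ.branches 2)))]
    simp only [Option.elim]
    congr 1
    refine Finset.sum_congr rfl fun m _ => ?_
    rw [ih m]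
    rfl

end treeAvg

lemma branches_le_of_mem {n k : ℕ} (hk : 1 ≤ k) {τ : BinTree} (h : τ ∈ treesOf n) :
    (τ.branches k : ℝ) ≤ n := by
  rw [← magnitude_of_mem_treesOf h]
  exact_mod_cast branches_le_magnitude hk τ

lemma treeAvg_stein {A : Type*} [CommRing A] [Algebra ℝ A] (n : ℕ) (g : ℤ → A) :
    treeAvg n (fun τ => ((n : A) - 2 * τ.branches 2) * (n - 2 * τ.branches 2 - 1) *
      g (τ.branches 2) - 4 * τ.branches 2 * (τ.branches 2 - 1) * g (τ.branches 2 - 1)) = 0 := by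
  rw [treeAvg, sum_branches_two_identity, smul_zero]

lemma treeAvg_sq_branches_two_sub_le (n : ℕ) :
    treeAvg n (fun τ => ((τ.branches 2 : ℝ) - n / 4) ^ 2) ≤ (9 / 4 * n : ℝ) := by
  rcases Nat.eq_zero_or_pos n with rfl | hn
  · simp [treeAvg, treesOf]
  have hn' : (0 : ℝ) < n := by exact_mod_cast hn
  have hst := treeAvg_stein n (fun m : ℤ => (m : ℝ) - n / 4)
  have hle := treeAvg_mono (n := n) (f := fun τ => (4 * n : ℝ) * ((τ.branches 2 : ℝ) - n / 4) ^ 2)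
    (g := fun τ => (9 * n ^ 2 : ℝ) - (((n : ℝ) - 2 * τ.branches 2) * (n - 2 * τ.branches 2 - 1) *
      (((τ.branches 2 : ℤ) : ℝ) - n / 4) - 4 * τ.branches 2 * (τ.branches 2 - 1) *
        (((τ.branches 2 - 1 : ℤ) : ℝ) - n / 4)))
    (fun τ hτ => by
      have h1 := branches_le_of_mem (by norm_num : 1 ≤ 2) hτ
      have h0 : (0 : ℝ) ≤ τ.branches 2 := by positivity
      push_cast
      generalize (τ.branches 2 : ℝ) = M at *
      nlinarith [mul_nonneg h0 (sub_nonneg.2 h1)])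
  rw [treeAvg_sub, hst, treeAvg_const hn, treeAvg_const_mul, sub_zero] at hle
  nlinarith

lemma treeAvg_abs_branches_two_sub_le {n : ℕ} (hn : 1 ≤ n) :
    treeAvg n (fun τ => |(τ.branches 2 : ℝ) - n / 4|) ≤ 4 * √n := by
  have hn' : (0 : ℝ) < n := by exact_mod_cast hn
  have hs : 0 < √(n : ℝ) := Real.sqrt_pos.2 hn'
  have hle := treeAvg_mono (n := n) (f := fun τ => |(τ.branches 2 : ℝ) - n / 4|)
    (g := fun τ => (√n)⁻¹ * ((τ.branches 2 : ℝ) - n / 4) ^ 2 + √n) (fun τ _ => by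
      rw [← sq_abs]
      generalize |(τ.branches 2 : ℝ) - n / 4| = y
      rw [← div_eq_inv_mul, ← sub_le_iff_le_add, le_div_iff₀ hs]
      nlinarith [sq_nonneg (y - √n), sq_nonneg (y)])
  rw [treeAvg_add, treeAvg_const hn, treeAvg_const_mul] at hle
  have h2 : (√(n : ℝ))⁻¹ * treeAvg n (fun τ => ((τ.branches 2 : ℝ) - n / 4) ^ 2) ≤
      (√(n : ℝ))⁻¹ * (9 / 4 * n) := by
    gcongr
    exact treeAvg_sq_branches_two_sub_le n
  have h3 : (√(n : ℝ))⁻¹ * (9 / 4 * n) = 9 / 4 * √n := by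
    rw [inv_mul_eq_iff_eq_mul₀ hs.ne']
    nlinarith [Real.mul_self_sqrt hn'.le]
  linarith

lemma norm_one_sub_exp_sub_le (θ : ℝ) :
    ‖1 - Complex.exp (-(Complex.I * θ)) - Complex.I * θ‖ ≤ 2 * θ ^ 2 := by
  have hI : ‖-(Complex.I * (θ : ℂ))‖ = |θ| := by simp
  rcases le_total |θ| 1 with h | h
  · have := Complex.norm_exp_sub_one_sub_id_le (x := -(Complex.I * θ)) (by rwa [hI])
    rw [hI, sq_abs] at this
    rw [← norm_neg]
    calc _ = ‖Complex.exp (-(Complex.I * θ)) - 1 - -(Complex.I * θ)‖ := by congr 1; ring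
      _ ≤ θ ^ 2 := this
      _ ≤ _ := by nlinarith [sq_nonneg θ]
  · have h1 : ‖Complex.exp (-(Complex.I * θ)) - 1‖ ≤ |θ| := by
      have := Real.norm_exp_I_mul_ofReal_sub_one_le (x := -θ)
      rw [norm_neg, Real.norm_eq_abs] at this
      rwa [Complex.ofReal_neg, mul_neg] at this
    calc _ ≤ ‖1 - Complex.exp (-(Complex.I * θ))‖ + ‖Complex.I * (θ : ℂ)‖ := norm_sub_le _ _
      _ ≤ |θ| + |θ| := by rw [norm_sub_rev, ← norm_neg (Complex.I * (θ : ℂ)), hI]; gcongr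
      _ ≤ _ := by rw [← sq_abs]; nlinarith

lemma norm_treeAvg_mul_exp_sub_le {n : ℕ} (hn : 1 ≤ n) (θ : ℝ) :
    ‖4 * n * treeAvg n (fun τ => (((τ.branches 2 : ℝ) - n / 4 : ℝ) : ℂ) *
        Complex.exp (Complex.I * (θ * ((τ.branches 2 : ℝ) - n / 4 : ℝ)))) -
      Complex.I * θ * (n ^ 2 / 4) * treeAvg n (fun τ =>
        Complex.exp (Complex.I * (θ * ((τ.branches 2 : ℝ) - n / 4 : ℝ))))‖ ≤
      5 * n + 20 * n * √n * |θ| + 4 * n * |θ| + 8 * n ^ 2 * θ ^ 2 := by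
  set g : ℤ → ℂ := fun m => Complex.exp (Complex.I * (θ * ((m : ℝ) - n / 4 : ℝ))) with hg
  have hst := treeAvg_stein n g
  have hg1 (m : ℤ) : g (m - 1) = Complex.exp (-(Complex.I * θ)) * g m := by
    simp only [hg]
    rw [← Complex.exp_add]
    congr 1
    push_cast
    ring
  have hgn (m : ℤ) : ‖g m‖ = 1 := by
    simp only [hg]
    rw [← Complex.ofReal_mul, Complex.norm_exp_I_mul_ofReal]
  have hgm (τ : BinTree) : Complex.exp (Complex.I * (θ * ((τ.branches 2 : ℝ) - n / 4 : ℝ))) =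
      g (τ.branches 2) := by simp [hg]
  simp only [hgm]
  rw [← add_zero (_ - _), ← hst, ← treeAvg_const_mul, ← treeAvg_const_mul, ← treeAvg_sub,
    ← treeAvg_add]
  refine (norm_treeAvg_le n _).trans ((treeAvg_mono (g := fun τ =>
    (5 * n + 4 * n * |θ| + 8 * n ^ 2 * θ ^ 2 : ℝ) +
      (5 * n * |θ|) * |(τ.branches 2 : ℝ) - n / 4|) fun τ hτ => ?_).trans ?_)
  · have hM1 := branches_le_of_mem (by norm_num : 1 ≤ 2) hτ
    have hM0 : (0 : ℝ) ≤ τ.branches 2 := by positivity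
    have hMM : 0 ≤ (τ.branches 2 : ℝ) * (τ.branches 2 - 1) := by
      rcases Nat.eq_zero_or_pos (τ.branches 2) with h | h
      · simp [h]
      · have : (1 : ℝ) ≤ τ.branches 2 := by exact_mod_cast h
        exact mul_nonneg hM0 (by linarith)
    rw [hg1]
    have hexp := norm_one_sub_exp_sub_le θ
    have hgτ := hgn (τ.branches 2)
    generalize g (τ.branches 2) = G at *
    generalize Complex.exp (-(Complex.I * θ)) = e at *
    rw [← Complex.ofReal_natCast (τ.branches 2)] at *
    generalize (τ.branches 2 : ℝ) = M at *
    rw [← Complex.ofReal_natCast n] at *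
    generalize (n : ℝ) = N at *
    have hN : 0 ≤ N := hM0.trans hM1
    have key : 4 * (N : ℂ) * (((M - N / 4 : ℝ) : ℂ) * G) - Complex.I * θ * (N ^ 2 / 4) * G +
        (((N : ℂ) - 2 * M) * (N - 2 * M - 1) * G - 4 * M * (M - 1) * (e * G)) =
        (((6 * M - N : ℝ) : ℂ) + ((4 * (M - N / 4) * (M + N / 4) - 4 * M : ℝ) : ℂ) *
          (Complex.I * θ) + ((4 * (M * (M - 1)) : ℝ) : ℂ) * (1 - e - Complex.I * θ)) * G := by
      push_cast
      ring
    rw [key, norm_mul, hgτ, mul_one]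
    refine (norm_add₃_le).trans ?_
    rw [norm_mul, norm_mul, norm_mul, Complex.norm_I, Complex.norm_real, Complex.norm_real,
      Complex.norm_real, Complex.norm_real, one_mul]
    simp only [Real.norm_eq_abs]
    have b1 : |6 * M - N| ≤ 5 * N := abs_le.2 ⟨by linarith, by linarith⟩
    have b2 : |4 * (M - N / 4) * (M + N / 4) - 4 * M| ≤ 5 * N * |M - N / 4| + 4 * N := by
      refine (abs_sub _ _).trans ?_
      rw [abs_mul, abs_mul, abs_of_nonneg (by linarith : 0 ≤ M + N / 4),
        abs_of_nonneg (by linarith : 0 ≤ 4 * M), abs_of_pos (by norm_num : (0 : ℝ) < 4)]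
      nlinarith [abs_nonneg (M - N / 4)]
    have b3 : |4 * (M * (M - 1))| ≤ 4 * N ^ 2 := by
      rw [abs_of_nonneg (by positivity)]
      nlinarith
    calc _ ≤ 5 * N + (5 * N * |M - N / 4| + 4 * N) * |θ| + 4 * N ^ 2 * (2 * θ ^ 2) := by gcongr
      _ = _ := by ring
  · rw [treeAvg_add, treeAvg_const hn, treeAvg_const_mul]
    have := mul_le_mul_of_nonneg_left (treeAvg_abs_branches_two_sub_le hn)
      (by positivity : (0 : ℝ) ≤ 5 * n * |θ|)
    linarith

/-- The characteristic function of the normalised number of branches of order two. -/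
noncomputable def branchesCharFun (n : ℕ) (s : ℝ) : ℂ :=
  treeAvg n (fun τ => Complex.exp (Complex.I * (s * (((τ.branches 2 : ℝ) - n / 4) / √n : ℝ))))

lemma norm_branchesCharFun_deriv_add_le {n : ℕ} (hn : 1 ≤ n) (s : ℝ) :
    ‖treeAvg n (fun τ => Complex.I * (((τ.branches 2 : ℝ) - n / 4) / √n : ℝ) *
        Complex.exp (Complex.I * (s * (((τ.branches 2 : ℝ) - n / 4) / √n : ℝ)))) +
      s / 16 * branchesCharFun n s‖ ≤ (2 + 6 * |s| + 2 * s ^ 2) / √n := by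
  have hn' : (1 : ℝ) ≤ n := by exact_mod_cast hn
  have hs : 1 ≤ √(n : ℝ) := Real.one_le_sqrt.2 hn'
  have hs0 : 0 < √(n : ℝ) := by linarith
  have hsq : √(n : ℝ) * √n = n := Real.mul_self_sqrt (by linarith)
  have h := norm_treeAvg_mul_exp_sub_le hn (s / √n)
  have he (τ : BinTree) : Complex.exp (Complex.I * ((s / √n : ℝ) * ((τ.branches 2 : ℝ) - n / 4 : ℝ)))
      = Complex.exp (Complex.I * (s * (((τ.branches 2 : ℝ) - n / 4) / √n : ℝ))) := by
    congr 2
    push_cast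
    ring
  simp only [he] at h
  have hC : (√(n : ℝ) : ℂ) ≠ 0 := by exact_mod_cast hs0.ne'
  have hCn : (n : ℂ) = (√(n : ℝ) : ℂ) * (√(n : ℝ) : ℂ) := by
    rw [← Complex.ofReal_mul, hsq, Complex.ofReal_natCast]
  have key : treeAvg n (fun τ => Complex.I * (((τ.branches 2 : ℝ) - n / 4) / √n : ℝ) *
        Complex.exp (Complex.I * (s * (((τ.branches 2 : ℝ) - n / 4) / √n : ℝ)))) +
      s / 16 * branchesCharFun n s = Complex.I / (4 * n * √(n : ℝ)) *
      (4 * n * treeAvg n (fun τ => (((τ.branches 2 : ℝ) - n / 4 : ℝ) : ℂ) *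
        Complex.exp (Complex.I * (s * (((τ.branches 2 : ℝ) - n / 4) / √n : ℝ)))) -
      Complex.I * (s / √n : ℝ) * (n ^ 2 / 4) * treeAvg n (fun τ =>
        Complex.exp (Complex.I * (s * (((τ.branches 2 : ℝ) - n / 4) / √n : ℝ))))) := by
    have e1 : treeAvg n (fun τ => Complex.I * (((τ.branches 2 : ℝ) - n / 4) / √n : ℝ) *
        Complex.exp (Complex.I * (s * (((τ.branches 2 : ℝ) - n / 4) / √n : ℝ)))) =
        Complex.I / √(n : ℝ) * treeAvg n (fun τ => (((τ.branches 2 : ℝ) - n / 4 : ℝ) : ℂ) *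
        Complex.exp (Complex.I * (s * (((τ.branches 2 : ℝ) - n / 4) / √n : ℝ)))) := by
      rw [← treeAvg_const_mul]
      refine treeAvg_congr fun τ _ => ?_
      push_cast
      ring
    rw [e1, branchesCharFun]
    generalize treeAvg n (fun τ => (((τ.branches 2 : ℝ) - n / 4 : ℝ) : ℂ) *
        Complex.exp (Complex.I * (s * (((τ.branches 2 : ℝ) - n / 4) / √n : ℝ)))) = A
    generalize treeAvg n (fun τ =>
        Complex.exp (Complex.I * (s * (((τ.branches 2 : ℝ) - n / 4) / √n : ℝ)))) = B
    rw [hCn]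
    push_cast
    field_simp
    ring_nf
    rw [Complex.I_sq]
    ring
  rw [key, norm_mul]
  have hnorm : ‖Complex.I / (4 * n * √(n : ℝ))‖ = 1 / (4 * n * √n) := by
    rw [norm_div, Complex.norm_I, norm_mul, norm_mul, Complex.norm_real, Real.norm_of_nonneg hs0.le]
    simp
  rw [hnorm]
  have hθ : |s / √n| = |s| / √n := by rw [abs_div, abs_of_pos hs0]
  rw [hθ] at h
  calc _ ≤ 1 / (4 * n * √n) * (5 * n + 20 * n * √n * (|s| / √n) + 4 * n * (|s| / √n) +
        8 * n ^ 2 * (s / √n) ^ 2) := by gcongr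
    _ = (5 + 20 * |s| + 4 * (|s| / √n) + 8 * s ^ 2) / 4 / √n := by
      rw [div_pow, Real.sq_sqrt (by linarith)]
      field_simp
    _ ≤ _ := by
      have : |s| / √n ≤ |s| := div_le_self (abs_nonneg s) hs
      gcongr
      linarith

lemma hasDerivAt_branchesCharFun (n : ℕ) (s : ℝ) :
    HasDerivAt (branchesCharFun n)
      (treeAvg n (fun τ => Complex.I * (((τ.branches 2 : ℝ) - n / 4) / √n : ℝ) *
        Complex.exp (Complex.I * (s * (((τ.branches 2 : ℝ) - n / 4) / √n : ℝ))))) s := by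
  unfold branchesCharFun treeAvg
  refine HasDerivAt.const_smul _ (HasDerivAt.fun_sum fun τ _ => ?_)
  have h : HasDerivAt (fun s : ℝ => Complex.I * (s * (((τ.branches 2 : ℝ) - n / 4) / √n : ℝ)))
      (Complex.I * (1 * (((τ.branches 2 : ℝ) - n / 4) / √n : ℝ))) s :=
    ((HasDerivAt.ofReal_comp (hasDerivAt_id s)).mul_const _).const_mul _
  exact h.cexp.congr_deriv (by ring)

/-- The characteristic function of the normalised number of branches of order two is close to
that of the normal law of variance `1/16`. -/
lemma norm_branchesCharFun_sub_le {n : ℕ} (hn : 1 ≤ n) (s : ℝ) :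
    ‖branchesCharFun n s - Complex.exp (-(s ^ 2 / 32 : ℝ))‖ ≤
      (2 + 6 * |s| + 2 * s ^ 2) / √n * |s| := by
  have hd (u : ℝ) : HasDerivAt (fun u : ℝ => branchesCharFun n u * Complex.exp (u ^ 2 / 32 : ℝ))
      ((treeAvg n (fun τ => Complex.I * (((τ.branches 2 : ℝ) - n / 4) / √n : ℝ) *
        Complex.exp (Complex.I * (u * (((τ.branches 2 : ℝ) - n / 4) / √n : ℝ)))) +
        u / 16 * branchesCharFun n u) * Complex.exp (u ^ 2 / 32 : ℝ)) u := by
    have h1 : HasDerivAt (fun u : ℝ => u ^ 2 / 32) (u / 16) u := by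
      refine ((hasDerivAt_pow 2 u).div_const 32).congr_deriv ?_
      norm_num
      ring
    have h2 := (hasDerivAt_branchesCharFun n u).mul (HasDerivAt.ofReal_comp h1).cexp
    refine HasDerivAt.congr_deriv h2 ?_
    push_cast
    ring
  have hmv := Convex.norm_image_sub_le_of_norm_hasDerivWithin_le (s := Set.Icc (-|s|) |s|)
    (C := (2 + 6 * |s| + 2 * s ^ 2) / √n * Real.exp (s ^ 2 / 32))
    (fun u _ => (hd u).hasDerivWithinAt) (fun u hu => by
      have hus : |u| ≤ |s| := abs_le.2 hu
      have hus2 : u ^ 2 ≤ s ^ 2 := sq_le_sq.2 hus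
      rw [norm_mul, Complex.norm_exp, Complex.ofReal_re]
      refine mul_le_mul ((norm_branchesCharFun_deriv_add_le hn u).trans ?_) ?_
        (by positivity) (by positivity)
      · gcongr
      · gcongr) (convex_Icc _ _) (x := 0) (y := s) (by simp) ⟨neg_abs_le s, le_abs_self s⟩
  have h0 : branchesCharFun n 0 = 1 := by
    simp [branchesCharFun, treeAvg_const hn]
  simp only [h0, sub_zero, Real.norm_eq_abs] at hmv
  have he : Real.exp (s ^ 2 / 32) * Real.exp (-(s ^ 2 / 32)) = 1 := by
    rw [← Real.exp_add, add_neg_cancel, Real.exp_zero]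
  have heC : Complex.exp (s ^ 2 / 32 : ℝ) * Complex.exp (-(s ^ 2 / 32 : ℝ)) = 1 := by
    rw [← Complex.exp_add, add_neg_cancel, Complex.exp_zero]
  have e1 : branchesCharFun n s - Complex.exp (-(s ^ 2 / 32 : ℝ)) =
      (branchesCharFun n s * Complex.exp (s ^ 2 / 32 : ℝ) - 1) *
        Complex.exp (-(s ^ 2 / 32 : ℝ)) := by
    linear_combination (-branchesCharFun n s) * heC
  have e2 : ‖Complex.exp (-(s ^ 2 / 32 : ℝ))‖ = Real.exp (-(s ^ 2 / 32)) := by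
    rw [Complex.norm_exp, ← Complex.ofReal_neg, Complex.ofReal_re]
  rw [e1, norm_mul, e2]
  simp only [ne_eq, OfNat.ofNat_ne_zero, not_false_eq_true, zero_pow, zero_div,
    Complex.ofReal_zero, Complex.exp_zero, mul_one] at hmv
  calc _ ≤ (2 + 6 * |s| + 2 * s ^ 2) / √n * Real.exp (s ^ 2 / 32) * |s| *
        Real.exp (-(s ^ 2 / 32)) := by gcongr
    _ = (2 + 6 * |s| + 2 * s ^ 2) / √n * |s| *
        (Real.exp (s ^ 2 / 32) * Real.exp (-(s ^ 2 / 32))) := by ring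
    _ = _ := by rw [he, mul_one]

lemma tendsto_treeAvg_branches_sq (k : ℕ) :
    Tendsto (fun n : ℕ => treeAvg n
      (fun τ => ((τ.branches (k + 1) : ℝ) / n - (1 / 4) ^ k) ^ 2)) atTop (𝓝 (0 : ℝ)) := by
  induction k with
  | zero =>
    refine tendsto_const_nhds.congr' ?_
    filter_upwards [eventually_ge_atTop 1] with n hn
    have hn' : (n : ℝ) ≠ 0 := by positivity
    rw [treeAvg_congr (g := fun _ => (0 : ℝ)), treeAvg_const hn]
    intro τ hτ
    rw [zero_add, branches_one, magnitude_of_mem_treesOf hτ]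
    simp [hn']
  | succ k ih =>
    have hlim : Tendsto (fun n : ℕ => (9 / 2 : ℝ) * (n : ℝ)⁻¹ + 1 / 8 * treeAvg n
        (fun τ => ((τ.branches (k + 1) : ℝ) / n - (1 / 4) ^ k) ^ 2)) atTop (𝓝 0) := by
      have h := (tendsto_inv_atTop_nhds_zero_nat (𝕜 := ℝ)).const_mul (9 / 2 : ℝ)
      simpa only [mul_zero, add_zero] using h.add (ih.const_mul (1 / 8))
    refine tendsto_of_tendsto_of_tendsto_of_le_of_le' tendsto_const_nhds hlim ?_ ?_
    · filter_upwards [eventually_ge_atTop 1] with n hn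
      rw [← treeAvg_const hn (0 : ℝ)]
      exact treeAvg_mono fun τ _ => sq_nonneg _
    · filter_upwards [eventually_ge_atTop 1] with n hn
      have hn' : (0 : ℝ) < n := by exact_mod_cast hn
      have hvar : treeAvg n (fun τ => ((τ.branches (k + 1 + 1) : ℝ) - τ.branches (k + 1) / 4) ^ 2) ≤
          (9 / 4 * n : ℝ) := by
        rw [treeAvg_branches_eq (by omega) n (fun a b => ((b : ℝ) - a / 4) ^ 2),
          ← treeAvg_const hn (9 / 4 * n : ℝ)]
        refine treeAvg_mono fun τ hτ => ?_
        split_ifs with h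
        · simp
        · have := branches_le_of_mem (show 1 ≤ k + 1 by omega) hτ
          exact (treeAvg_sq_branches_two_sub_le _).trans (by linarith)
      have hle : treeAvg n (fun τ => ((τ.branches (k + 1 + 1) : ℝ) / n - (1 / 4) ^ (k + 1)) ^ 2) ≤
          treeAvg n (fun τ => (2 / n ^ 2 : ℝ) *
            ((τ.branches (k + 1 + 1) : ℝ) - τ.branches (k + 1) / 4) ^ 2 +
            1 / 8 * ((τ.branches (k + 1) : ℝ) / n - (1 / 4) ^ k) ^ 2) := by
        refine treeAvg_mono fun τ _ => ?_
        have e : (τ.branches (k + 1 + 1) : ℝ) / n - (1 / 4) ^ (k + 1) =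
            ((τ.branches (k + 1 + 1) : ℝ) - τ.branches (k + 1) / 4) / n +
            ((τ.branches (k + 1) : ℝ) / n - (1 / 4) ^ k) / 4 := by
          rw [pow_succ]; ring
        rw [e]
        refine (add_sq_le).trans (le_of_eq ?_)
        ring
      rw [treeAvg_add, treeAvg_const_mul, treeAvg_const_mul] at hle
      refine hle.trans ?_
      refine add_le_add ((mul_le_mul_of_nonneg_left hvar (by positivity)).trans
        (le_of_eq ?_)) le_rfl
      field_simp
      norm_num

lemma tendsto_treeAvg_of_concentrated {k : ℕ} {Φ : ℕ → ℕ → ℂ} {L : ℂ}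
    (hb : ∀ n m, ‖Φ n m - L‖ ≤ 2)
    (h : Tendsto (fun p : ℕ × ℕ => Φ p.1 p.2)
      (comap Prod.fst atTop ⊓ comap (fun p : ℕ × ℕ => (p.2 : ℝ) / p.1) (𝓝 ((1 / 4) ^ k))) (𝓝 L)) :
    Tendsto (fun n => treeAvg n (fun τ => Φ n (τ.branches (k + 1)))) atTop (𝓝 L) := by
  rw [Metric.tendsto_nhds]
  intro ε hε
  obtain ⟨⟨N, δ⟩, ⟨-, hδ⟩, hN⟩ := (((atTop_basis (α := ℕ)).comap Prod.fst).inf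
    ((Metric.nhds_basis_ball (x := ((1 : ℝ) / 4) ^ k)).comap
      (fun p : ℕ × ℕ => (p.2 : ℝ) / p.1))).eventually_iff.1
        (Metric.tendsto_nhds.1 h (ε / 2) (half_pos hε))
  have hlim := (tendsto_treeAvg_branches_sq k).const_mul (2 / δ ^ 2)
  rw [mul_zero] at hlim
  filter_upwards [eventually_ge_atTop 1, eventually_ge_atTop N,
    hlim.eventually (gt_mem_nhds (half_pos hε))] with n hn hnN hsmall
  rw [dist_eq_norm, ← treeAvg_const hn L, ← treeAvg_sub]
  refine (norm_treeAvg_le n _).trans_lt ((treeAvg_mono (g := fun τ => ε / 2 + 2 / δ ^ 2 *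
    ((τ.branches (k + 1) : ℝ) / n - (1 / 4) ^ k) ^ 2) fun τ _ => ?_).trans_lt ?_)
  · by_cases hc : |(τ.branches (k + 1) : ℝ) / n - (1 / 4) ^ k| < δ
    · have := hN (x := (n, τ.branches (k + 1))) ⟨hnN, by simpa [Real.dist_eq] using hc⟩
      rw [dist_eq_norm] at this
      exact this.le.trans (le_add_of_nonneg_right (by positivity))
    · have h2 : δ ^ 2 ≤ ((τ.branches (k + 1) : ℝ) / n - (1 / 4) ^ k) ^ 2 := by
        rw [← sq_abs (_ - _)]
        exact pow_le_pow_left₀ (le_of_lt hδ) (not_lt.1 hc) 2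
      have h3 : 2 ≤ 2 / δ ^ 2 * ((τ.branches (k + 1) : ℝ) / n - (1 / 4) ^ k) ^ 2 := by
        rw [div_mul_eq_mul_div, le_div_iff₀ (by have : 0 < δ := hδ; positivity)]
        linarith
      linarith [hb n (τ.branches (k + 1))]
  · rw [treeAvg_add, treeAvg_const hn, treeAvg_const_mul]
    linarith

lemma tendsto_treeAvg_exp_ratio (k : ℕ) (t : ℝ) :
    Tendsto (fun n : ℕ => treeAvg n (fun τ => Complex.exp (Complex.I * (t * (√n *
        ((τ.branches (k + 1 + 1) : ℝ) / τ.branches (k + 1) - 1 / 4) : ℝ)))))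
      atTop (𝓝 (Complex.exp (-(t ^ 2 * 4 ^ k / 32 : ℝ)))) := by
  set G : ℕ → ℕ → ℕ → ℂ := fun n a b =>
    Complex.exp (Complex.I * (t * (√n * ((b : ℝ) / a - 1 / 4) : ℝ))) with hG
  set Φ : ℕ → ℕ → ℂ := fun n m => if m = 0 then G n 0 0 else
    treeAvg m (fun σ => G n m (σ.branches 2)) with hΦ
  have hGn (n a b) : ‖G n a b‖ = 1 := by
    simp only [hG]
    rw [← Complex.ofReal_mul, Complex.norm_exp_I_mul_ofReal]
  have hΦn (n m) : ‖Φ n m‖ ≤ 1 := by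
    simp only [hΦ]
    split_ifs with h
    · exact (hGn _ _ _).le
    · refine (norm_treeAvg_le _ _).trans ?_
      simp only [hGn]
      exact (treeAvg_const (Nat.one_le_iff_ne_zero.2 h) (1 : ℝ)).le
  have hL : ‖Complex.exp (-(t ^ 2 * 4 ^ k / 32 : ℝ))‖ ≤ 1 := by
    rw [Complex.norm_exp, ← Complex.ofReal_neg, Complex.ofReal_re]
    exact Real.exp_le_one_iff.2 (neg_nonpos.2 (by positivity))
  have hmain := tendsto_treeAvg_of_concentrated (k := k) (Φ := Φ)
    (L := Complex.exp (-(t ^ 2 * 4 ^ k / 32 : ℝ)))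
    (fun n m => (norm_sub_le _ _).trans (by linarith [hΦn n m])) ?_
  · refine hmain.congr fun n => ?_
    exact (treeAvg_branches_eq (by omega) n (G n)).symm
  set l := comap (Prod.fst : ℕ × ℕ → ℕ) atTop ⊓
    comap (fun p : ℕ × ℕ => (p.2 : ℝ) / p.1) (𝓝 ((1 / 4) ^ k)) with hl
  have hfst : Tendsto (fun p : ℕ × ℕ => (p.1 : ℝ)) l atTop :=
    tendsto_natCast_atTop_atTop.comp (tendsto_comap.mono_left inf_le_left)
  have hratio : Tendsto (fun p : ℕ × ℕ => (p.2 : ℝ) / p.1) l (𝓝 ((1 / 4) ^ k)) :=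
    tendsto_comap.mono_left inf_le_right
  have ha : (0 : ℝ) < (1 / 4) ^ k := by positivity
  have hpos1 : ∀ᶠ p in l, (0 : ℝ) < p.1 := hfst.eventually_gt_atTop 0
  have hsnd : Tendsto (fun p : ℕ × ℕ => (p.2 : ℝ)) l atTop := by
    refine (hfst.atTop_mul_pos ha hratio).congr' ?_
    filter_upwards [hpos1] with p hp
    field_simp
  have hpos2 : ∀ᶠ p in l, (0 : ℝ) < p.2 := hsnd.eventually_gt_atTop 0
  have hs : Tendsto (fun p : ℕ × ℕ => t / √((p.2 : ℝ) / p.1)) l (𝓝 (t / √((1 / 4) ^ k))) :=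
    tendsto_const_nhds.div hratio.sqrt (Real.sqrt_pos.2 ha).ne'
  have hexp : Tendsto (fun p : ℕ × ℕ =>
      Complex.exp (-((t / √((p.2 : ℝ) / p.1)) ^ 2 / 32 : ℝ))) l
      (𝓝 (Complex.exp (-(t ^ 2 * 4 ^ k / 32 : ℝ)))) := by
    have e : t ^ 2 * 4 ^ k / 32 = (t / √((1 / 4) ^ k)) ^ 2 / 32 := by
      rw [div_pow, Real.sq_sqrt ha.le, one_div, inv_pow, div_inv_eq_mul]
    rw [e]
    have hcont : Continuous fun s : ℝ => Complex.exp (-(s ^ 2 / 32 : ℝ)) := by fun_prop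
    exact hcont.continuousAt.tendsto.comp hs
  have herr : Tendsto (fun p : ℕ × ℕ => (2 + 6 * |t / √((p.2 : ℝ) / p.1)| +
      2 * (t / √((p.2 : ℝ) / p.1)) ^ 2) / √p.2 * |t / √((p.2 : ℝ) / p.1)|) l (𝓝 0) := by
    have h1 := (((tendsto_const_nhds (x := (2 : ℝ))).add (hs.abs.const_mul 6)).add
      ((hs.pow 2).const_mul 2)).div_atTop (Real.tendsto_sqrt_atTop.comp hsnd)
    simpa using h1.mul hs.abs
  have hΦeq : ∀ᶠ p in l, branchesCharFun p.2 (t / √((p.2 : ℝ) / p.1)) = Φ p.1 p.2 := by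
    filter_upwards [hpos1, hpos2] with p hp1 hp2
    have h2 : p.2 ≠ 0 := by exact_mod_cast hp2.ne'
    simp only [hΦ, if_neg h2, branchesCharFun, hG]
    refine treeAvg_congr fun τ _ => ?_
    congr 2
    rw [← Complex.ofReal_mul, ← Complex.ofReal_mul]
    congr 1
    have hq1 := Real.sqrt_pos.2 hp1
    have hq2 := Real.sqrt_pos.2 hp2
    rw [Real.sqrt_div hp2.le]
    have hqq : (p.2 : ℝ) = √p.2 * √p.2 := (Real.mul_self_sqrt hp2.le).symm
    generalize √(p.1 : ℝ) = u at *
    generalize √(p.2 : ℝ) = v at *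
    rw [hqq]
    field_simp
  have hdiff : Tendsto (fun p : ℕ × ℕ => branchesCharFun p.2 (t / √((p.2 : ℝ) / p.1)) -
      Complex.exp (-((t / √((p.2 : ℝ) / p.1)) ^ 2 / 32 : ℝ))) l (𝓝 0) := by
    refine squeeze_zero_norm' ?_ herr
    filter_upwards [hpos2] with p hp
    exact norm_branchesCharFun_sub_le (by exact_mod_cast hp) _
  have := hdiff.add hexp
  simp only [sub_add_cancel, zero_add] at this
  exact this.congr' hΦeq

/-- The law of a real random variable under the uniform measure on trees of magnitude `n`. -/
noncomputable def treeLaw (n : ℕ) (X : BinTree → ℝ) : Measure ℝ :=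
  ∑ τ ∈ treesOf n, ((treesOf n).card : ENNReal)⁻¹ • Measure.dirac (X τ)

lemma isProbabilityMeasure_treeLaw {n : ℕ} (hn : 1 ≤ n) (X : BinTree → ℝ) :
    IsProbabilityMeasure (treeLaw n X) := by
  constructor
  have hc := card_treesOf_pos hn
  simp only [treeLaw, Measure.finsetSum_apply, Measure.smul_apply, measure_univ, smul_eq_mul,
    mul_one, Finset.sum_const, nsmul_eq_mul]
  exact ENNReal.mul_inv_cancel (by exact_mod_cast hc.ne') (ENNReal.natCast_ne_top _)

lemma integral_treeLaw {E : Type*} [NormedAddCommGroup E] [NormedSpace ℝ E] [CompleteSpace E]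
    (n : ℕ) (X : BinTree → ℝ) (f : ℝ → E) :
    ∫ x, f x ∂(treeLaw n X) = treeAvg n (fun τ => f (X τ)) := by
  rcases (treesOf n).eq_empty_or_nonempty with h | h
  · simp [treeLaw, treeAvg, h]
  have hc : ((treesOf n).card : ENNReal)⁻¹ ≠ ⊤ :=
    ENNReal.inv_ne_top.2 (by exact_mod_cast (Finset.card_pos.2 h).ne')
  rw [treeLaw, integral_finsetSum_measure
    (fun τ _ => (integrable_dirac (by simp)).smul_measure hc)]
  simp [integral_smul_measure, treeAvg, Finset.smul_sum]

/-- CLT for the bifurcation ratio of general order `r ≥ 1`: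
`√n (S_{r+1,n}/S_{r,n} − 1/4)` converges in distribution to `N(0, 4^{r−3})`.
The ratio is `0` on trees with `S_{r,n} = 0` (Lean's division-by-zero convention). -/
theorem clt_bifurcation_ratio (r : ℕ) (hr : 1 ≤ r) :
    ∀ f : BoundedContinuousFunction ℝ ℝ,
      Tendsto (fun n : ℕ => expect n (fun τ =>
          f (Real.sqrt n *
            ((BinTree.branches (r+1) τ : ℝ) / (BinTree.branches r τ : ℝ) - 1/4))))
        atTop (𝓝 (∫ x, f x ∂(gaussianReal 0 ((4 : ℝ≥0) ^ ((r : ℤ) - 3))))) := by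
  obtain ⟨k, rfl⟩ : ∃ k, r = k + 1 := ⟨r - 1, by omega⟩
  intro f
  set X : ℕ → BinTree → ℝ := fun n τ =>
    √n * ((τ.branches (k + 1 + 1) : ℝ) / τ.branches (k + 1) - 1 / 4) with hX
  have hP (n : ℕ) := isProbabilityMeasure_treeLaw (Nat.succ_pos n) (X (n + 1))
  let μ (n : ℕ) : ProbabilityMeasure ℝ := ⟨treeLaw (n + 1) (X (n + 1)), hP n⟩
  let ν : ProbabilityMeasure ℝ :=
    ⟨gaussianReal 0 ((4 : ℝ≥0) ^ (((k + 1 : ℕ) : ℤ) - 3)), inferInstance⟩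
  have hweak : Tendsto μ atTop (𝓝 ν) := by
    rw [ProbabilityMeasure.tendsto_iff_tendsto_charFun]
    intro t
    simp only [μ, ν, ProbabilityMeasure.coe_mk]
    rw [charFun_gaussianReal]
    simp only [charFun_apply_real, integral_treeLaw]
    have hlim := (tendsto_add_atTop_iff_nat 1).2 (tendsto_treeAvg_exp_ratio k t)
    have e : Complex.exp (t * (0 : ℝ) * Complex.I -
        (((4 : ℝ≥0) ^ (((k + 1 : ℕ) : ℤ) - 3) : ℝ≥0) : ℝ) * t ^ 2 / 2) =
        Complex.exp (-(t ^ 2 * 4 ^ k / 32 : ℝ)) := by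
      have : (((4 : ℝ≥0) ^ (((k + 1 : ℕ) : ℤ) - 3) : ℝ≥0) : ℝ) = 4 ^ k / 16 := by
        rw [NNReal.coe_zpow, show ((k + 1 : ℕ) : ℤ) - 3 = k - 2 by push_cast; ring,
          zpow_sub₀ (by norm_num)]
        norm_num
      rw [this]
      congr 1
      push_cast
      ring
    rw [e]
    refine hlim.congr fun n => treeAvg_congr fun τ _ => ?_
    simp only [hX]
    congr 1
    ring
  have hweak' := ProbabilityMeasure.tendsto_iff_forall_integral_tendsto.1 hweak f
  simp only [μ, ν, ProbabilityMeasure.coe_mk, integral_treeLaw] at hweak'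
  simp only [expect_eq_treeAvg]
  exact (tendsto_add_atTop_iff_nat 1).1 hweak'
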